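/- Let ε be a real number with 0 < ε < 2, let δ = ε/(2(2−ε)), and let k be an integer with k > 8π/√(δ + δ²). Then every planar straight-line drawing of the graph G_k has edge-length ratio strictly greater than 2 − ε. -/

import Mathlib

noncomputable section

/-- The Euclidean plane. -/
abbrev Plane : Type := EuclideanSpace ℝ (Fin 2)

/-- A planar straight-line drawing of a simple graph `G`. -/
def IsPlanarDrawing {V : Type} (G : SimpleGraph V) (ρ : V → Plane) : Prop :=
  Function.Injective ρ ∧
  (∀ u v w : V, G.Adj u v → w ≠ u → w ≠ v → ρ w ∉ segment ℝ (ρ u) (ρ v)) ∧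
  (∀ u v x y : V, G.Adj u v → G.Adj x y → s(u, v) ≠ s(x, y) →
    segment ℝ (ρ u) (ρ v) ∩ segment ℝ (ρ x) (ρ y) =
      {p : Plane | ∃ w : V, (w = u ∨ w = v) ∧ (w = x ∨ w = y) ∧ p = ρ w})

/-- The edge-length ratio of a drawing: longest edge length divided by shortest. -/
def edgeLengthRatio {V : Type} (G : SimpleGraph V) (ρ : V → Plane) : ℝ :=
  sSup {d : ℝ | ∃ u v : V, G.Adj u v ∧ d = dist (ρ u) (ρ v)} /
  sInf {d : ℝ | ∃ u v : V, G.Adj u v ∧ d = dist (ρ u) (ρ v)}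

/-- Vertices of the graph `G_k`: the apex `v` (`Sum.inl ()`), the fan vertices
`u₀, …, u_{k+1}` (`Sum.inr (Sum.inl j)` for `j : Fin (k+2)`), and the pendant vertices
`w₁, …, w_{k+1}` (`Sum.inr (Sum.inr m)` for `m : Fin (k+1)`, with `m` encoding `w_{m+1}`). -/
abbrev GkV (k : ℕ) : Type := Unit ⊕ Fin (k + 2) ⊕ Fin (k + 1)

/-- The graph `G_k`: the apex `v` is adjacent to every `u_j`; consecutive `u_j` are
adjacent; and the pendant vertex `w_{m+1}` is adjacent to `u_m` and `u_{m+1}`. -/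
def Gk (k : ℕ) : SimpleGraph (GkV k) :=
  SimpleGraph.fromRel fun a b =>
    (∃ j : Fin (k + 2), a = Sum.inl () ∧ b = Sum.inr (Sum.inl j)) ∨
    (∃ i j : Fin (k + 2), a = Sum.inr (Sum.inl i) ∧ b = Sum.inr (Sum.inl j) ∧
      (i : ℕ) + 1 = (j : ℕ)) ∨
    (∃ (m : Fin (k + 1)) (i : Fin (k + 2)), a = Sum.inr (Sum.inr m) ∧
      b = Sum.inr (Sum.inl i) ∧ ((i : ℕ) = (m : ℕ) ∨ (i : ℕ) = (m : ℕ) + 1))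

open MeasureTheory

section Triangle

variable {t : Fin 3 → Plane}

/-- Twice the signed area of the triangle with vertices `t 0`, `t 1`, `t 2`. -/
def signedArea (t : Fin 3 → Plane) : ℝ :=
  (t 1 0 - t 0 0) * (t 2 1 - t 0 1) - (t 1 1 - t 0 1) * (t 2 0 - t 0 0)

/-- The closed triangle with vertices `t 0`, `t 1`, `t 2`. -/
def triangle (t : Fin 3 → Plane) : Set Plane := convexHull ℝ (Set.range t)

lemma convex_triangle (t : Fin 3 → Plane) : Convex ℝ (triangle t) := convex_convexHull ℝ _

lemma isCompact_triangle (t : Fin 3 → Plane) : IsCompact (triangle t) :=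
  (Set.finite_range t).isCompact_convexHull ℝ

lemma isClosed_triangle (t : Fin 3 → Plane) : IsClosed (triangle t) :=
  (isCompact_triangle t).isClosed

lemma vertex_mem_triangle (t : Fin 3 → Plane) (i : Fin 3) : t i ∈ triangle t :=
  subset_convexHull ℝ _ (Set.mem_range_self i)

lemma exists_affineBasis_of_signedArea_ne_zero (h : signedArea t ≠ 0) :
    ∃ b : AffineBasis (Fin 3) ℝ Plane, ⇑b = t := by
  have hi : AffineIndependent ℝ t := by
    refine affineIndependent_iff_not_collinear.2 fun hc => ?_
    obtain ⟨v, hv⟩ := (collinear_iff_of_mem (Set.mem_range_self 0)).1 hc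
    obtain ⟨r, hr⟩ := hv _ (Set.mem_range_self 1)
    obtain ⟨s, hs⟩ := hv _ (Set.mem_range_self 2)
    apply h
    simp only [signedArea, hr, hs, vadd_eq_add, PiLp.add_apply, PiLp.smul_apply, smul_eq_mul]
    ring
  exact ⟨⟨t, hi, hi.affineSpan_eq_top_iff_card_eq_finrank_add_one.2 (by simp)⟩, rfl⟩

lemma exists_mem_segment_of_mem_frontier (h : signedArea t ≠ 0) {x : Plane}
    (hx : x ∈ frontier (triangle t)) : ∃ i j, i ≠ j ∧ x ∈ segment ℝ (t i) (t j) := by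
  obtain ⟨b, rfl⟩ := exists_affineBasis_of_signedArea_ne_zero h
  rw [(isClosed_triangle _).frontier_eq, triangle, b.interior_convexHull,
    b.convexHull_eq_nonneg_coord] at hx
  obtain ⟨h0, hx⟩ := hx
  simp only [Set.mem_ofPred_eq, not_forall, not_lt] at h0 hx
  have e := b.linear_combination_coord_eq_self x
  have e1 := b.sum_coord_apply_eq_one x
  rw [Fin.sum_univ_three] at e e1
  obtain ⟨i, hi⟩ := hx
  have hi := le_antisymm hi (h0 i)
  fin_cases i <;> simp only [Fin.zero_eta, Fin.mk_one, Fin.reduceFinMk] at hi <;>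
    rw [hi] at e e1
  · exact ⟨1, 2, by decide, _, _, h0 1, h0 2, by linarith, by simpa using e⟩
  · exact ⟨0, 2, by decide, _, _, h0 0, h0 2, by linarith, by simpa using e⟩
  · exact ⟨0, 1, by decide, _, _, h0 0, h0 1, by linarith, by simpa using e⟩

lemma vertex_notMem_interior (h : signedArea t ≠ 0) (i : Fin 3) :
    t i ∉ interior (triangle t) := by
  obtain ⟨b, rfl⟩ := exists_affineBasis_of_signedArea_ne_zero h
  rw [triangle, b.interior_convexHull]
  intro hi
  have := hi (i + 1)
  rw [b.coord_apply_ne (by fin_cases i <;> decide)] at this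
  exact lt_irrefl _ this

lemma interior_triangle_nonempty (h : signedArea t ≠ 0) : (interior (triangle t)).Nonempty := by
  obtain ⟨b, rfl⟩ := exists_affineBasis_of_signedArea_ne_zero h
  exact ⟨_, b.centroid_mem_interior_convexHull⟩

lemma subset_interior_of_disjoint_frontier {X : Type*} [TopologicalSpace X] {s T : Set X}
    (hs : IsPreconnected s) (hd : Disjoint s (frontier T)) (hne : (s ∩ interior T).Nonempty) :
    s ⊆ interior T := by
  refine hs.subset_left_of_subset_union isOpen_interior isClosed_closure.isOpen_compl
    (Set.disjoint_left.2 fun x hx hx' => hx' (subset_closure (interior_subset hx))) ?_ hne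
  intro x hx
  by_contra hc
  rw [Set.mem_union, not_or, Set.mem_compl_iff, not_not] at hc
  exact Set.disjoint_left.1 hd hx ⟨hc.2, hc.1⟩

end Triangle

section Drawing

variable {V : Type} {G : SimpleGraph V} {ρ : V → Plane} {t t' : Fin 3 → V}

lemma mem_interior_of_adj (hρ : IsPlanarDrawing G ρ) (ht : Pairwise fun i j => G.Adj (t i) (t j))
    (h : signedArea (ρ ∘ t) ≠ 0) {x y : V} (hxy : G.Adj x y) (hy : y ∉ Set.range t)
    (hne : (segment ℝ (ρ x) (ρ y) ∩ interior (triangle (ρ ∘ t))).Nonempty) :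
    ρ y ∈ interior (triangle (ρ ∘ t)) := by
  obtain ⟨p, hp, hpi⟩ := hne
  have hsub : segment ℝ p (ρ y) ⊆ segment ℝ (ρ x) (ρ y) :=
    (convex_segment _ _).segment_subset hp (right_mem_segment ℝ _ _)
  refine subset_interior_of_disjoint_frontier (convex_segment p (ρ y)).isPreconnected ?_
    ⟨p, left_mem_segment ℝ _ _, hpi⟩ (right_mem_segment ℝ _ _)
  rw [Set.disjoint_left]
  intro q hq hqf
  obtain ⟨i, j, hij, hqs⟩ := exists_mem_segment_of_mem_frontier h hqf
  have hne : s(x, y) ≠ s(t i, t j) := by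
    intro he
    have : y ∈ s(t i, t j) := he ▸ Sym2.mem_mk_right x y
    rcases Sym2.mem_iff.1 this with rfl | rfl <;> exact hy ⟨_, rfl⟩
  have hmem : q ∈ segment ℝ (ρ x) (ρ y) ∩ segment ℝ (ρ (t i)) (ρ (t j)) := ⟨hsub hq, hqs⟩
  rw [hρ.2.2 x y _ _ hxy (ht hij) hne] at hmem
  obtain ⟨z, hz, hz', rfl⟩ := hmem
  have hzt : z ∈ Set.range t := by rcases hz' with rfl | rfl <;> exact ⟨_, rfl⟩
  have hzx : z = x := hz.resolve_right fun hzy => hy (hzy ▸ hzt)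
  subst hzx
  -- both `p ∈ [z, y]` and `z ∈ [p, y]` force `p = z`
  have hpz : p = ρ z := by
    have h1 := dist_add_dist_of_mem_segment hp
    have h2 := dist_add_dist_of_mem_segment hq
    have h3 := dist_comm (ρ z) p
    exact dist_le_zero.1 (by linarith)
  obtain ⟨l, rfl⟩ := hzt
  rw [hpz] at hpi
  exact vertex_notMem_interior h l hpi

lemma exists_vertex_mem_interior (hρ : IsPlanarDrawing G ρ)
    (ht : Pairwise fun i j => G.Adj (t i) (t j)) (ht' : Pairwise fun i j => G.Adj (t' i) (t' j))
    (h : signedArea (ρ ∘ t) ≠ 0) (h' : signedArea (ρ ∘ t') ≠ 0)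
    (hs : ∀ i j, i ≠ j → t i ∉ Set.range t' ∨ t j ∉ Set.range t')
    (hs' : ∀ i j, i ≠ j → t' i ∉ Set.range t ∨ t' j ∉ Set.range t)
    (hne : (interior (triangle (ρ ∘ t)) ∩ interior (triangle (ρ ∘ t'))).Nonempty) :
    (∃ i, ρ (t i) ∈ interior (triangle (ρ ∘ t'))) ∨
      ∃ i, ρ (t' i) ∈ interior (triangle (ρ ∘ t)) := by
  by_contra! hc
  obtain ⟨hc, hc'⟩ := hc
  have key : ∀ t t' : Fin 3 → V, (Pairwise fun i j => G.Adj (t i) (t j)) →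
      (Pairwise fun i j => G.Adj (t' i) (t' j)) → signedArea (ρ ∘ t) ≠ 0 →
      signedArea (ρ ∘ t') ≠ 0 → (∀ i j, i ≠ j → t i ∉ Set.range t' ∨ t j ∉ Set.range t') →
      (∀ i, ρ (t i) ∉ interior (triangle (ρ ∘ t'))) →
      (interior (triangle (ρ ∘ t')) ∩ interior (triangle (ρ ∘ t))).Nonempty →
      interior (triangle (ρ ∘ t')) ⊆ interior (triangle (ρ ∘ t)) := by
    intro t t' ht ht' h h' hs hc hne
    refine subset_interior_of_disjoint_frontier (convex_triangle _).interior.isPreconnected ?_ hne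
    rw [Set.disjoint_left]
    intro q hq hqf
    obtain ⟨i, j, hij, hqs⟩ := exists_mem_segment_of_mem_frontier h hqf
    rcases hs i j hij with hi | hj
    · exact hc i (mem_interior_of_adj hρ ht' h' (ht hij.symm) hi
        ⟨q, by rw [segment_symm]; exact hqs, hq⟩)
    · exact hc j (mem_interior_of_adj hρ ht' h' (ht hij) hj ⟨q, hqs, hq⟩)
  have hsub := key t' t ht' ht h' h hs' hc' hne
  obtain ⟨i, hi⟩ : ∃ i, t i ∉ Set.range t' := by
    rcases hs 0 1 (by decide) with hi | hi <;> exact ⟨_, hi⟩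
  have hmem : ρ (t i) ∈ frontier (triangle (ρ ∘ t')) := by
    refine ⟨?_, hc i⟩
    have h1 := closure_mono (hsub.trans interior_subset)
    rw [(convex_triangle _).closure_interior_eq_closure_of_nonempty_interior
      (interior_triangle_nonempty h)] at h1
    exact h1 (subset_closure (vertex_mem_triangle (ρ ∘ t) i))
  obtain ⟨a, b, hab, hq⟩ := exists_mem_segment_of_mem_frontier h' hmem
  exact hρ.2.1 _ _ _ (ht' hab) (fun e => hi ⟨a, e.symm⟩) (fun e => hi ⟨b, e.symm⟩) hq

end Drawing

section Area

variable {t : Fin 3 → Plane}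

lemma smul_add_smul_add_smul_mem_triangle (t : Fin 3 → Plane) {α β γ : ℝ} (hα : 0 ≤ α)
    (hβ : 0 ≤ β) (hγ : 0 ≤ γ) (h : α + β + γ = 1) :
    α • t 0 + β • t 1 + γ • t 2 ∈ triangle t := by
  have := (convex_triangle t).sum_mem (t := Finset.univ) (w := ![α, β, γ]) (z := t)
    (by intro i _; fin_cases i <;> simpa) (by simpa [Fin.sum_univ_three] using h)
    (fun i _ => vertex_mem_triangle t i)
  simpa [Fin.sum_univ_three] using this

lemma exists_eq_of_mem_triangle (h : signedArea t ≠ 0) {x : Plane} (hx : x ∈ triangle t) :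
    ∃ α β γ : ℝ, 0 ≤ α ∧ 0 ≤ β ∧ 0 ≤ γ ∧ α + β + γ = 1 ∧ x = α • t 0 + β • t 1 + γ • t 2 := by
  obtain ⟨b, rfl⟩ := exists_affineBasis_of_signedArea_ne_zero h
  rw [triangle, b.convexHull_eq_nonneg_coord] at hx
  have e := b.linear_combination_coord_eq_self x
  have e1 := b.sum_coord_apply_eq_one x
  rw [Fin.sum_univ_three] at e e1
  exact ⟨_, _, _, hx 0, hx 1, hx 2, e1, e.symm⟩

lemma volume_parallelepiped_plane (p q : Plane) :
    volume (parallelepiped ![p, q]) = ENNReal.ofReal |p 0 * q 1 - p 1 * q 0| := by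
  rw [← (EuclideanSpace.basisFun (Fin 2) ℝ).addHaar_eq_volume, Measure.addHaar_parallelepiped,
    Module.Basis.det_apply, Matrix.det_fin_two]
  simp [Module.Basis.toMatrix_apply, mul_comm]

lemma volume_triangle_ne_top (t : Fin 3 → Plane) : volume (triangle t) ≠ ⊤ :=
  (isCompact_triangle t).measure_lt_top.ne

lemma abs_signedArea_le (t : Fin 3 → Plane) : |signedArea t| ≤ 2 * volume.real (triangle t) := by
  have hsub : parallelepiped ![t 1 - t 0, t 2 - t 0] ⊆
      (fun x => t 0 + x) ⁻¹' triangle t ∪ (fun x => (t 1 + t 2 - t 0) - x) ⁻¹' triangle t := by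
    intro x hx
    obtain ⟨a, ⟨ha0, ha1⟩, rfl⟩ := (mem_parallelepiped_iff _ _).1 hx
    have h00 := ha0 0
    have h01 := ha0 1
    have h10 := ha1 0
    have h11 := ha1 1
    simp only [Pi.zero_apply, Pi.one_apply] at h00 h01 h10 h11
    simp only [Fin.sum_univ_two, Matrix.cons_val_zero, Matrix.cons_val_one]
    rcases le_total (a 0 + a 1) 1 with h | h
    · left
      have := smul_add_smul_add_smul_mem_triangle t (sub_nonneg.2 h) h00 h01 (by ring)
      rw [Set.mem_preimage]
      convert this using 1
      module
    · right
      have := smul_add_smul_add_smul_mem_triangle t (sub_nonneg.2 h) (sub_nonneg.2 h10)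
        (sub_nonneg.2 h11) (by ring)
      rw [Set.mem_preimage]
      convert this using 1
      module
  have hle := (measure_mono (μ := volume) hsub).trans (measure_union_le _ _)
  have hrefl : volume ((fun x => (t 1 + t 2 - t 0) - x) ⁻¹' triangle t) = volume (triangle t) :=
    (Measure.measurePreserving_sub_left volume (t 1 + t 2 - t 0)).measure_preimage
      (isClosed_triangle t).measurableSet.nullMeasurableSet
  rw [volume_parallelepiped_plane, measure_preimage_add, hrefl, ← two_mul] at hle
  have := ENNReal.toReal_mono (ENNReal.mul_ne_top (by simp) (volume_triangle_ne_top t)) hle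
  rw [ENNReal.toReal_ofReal (abs_nonneg _), ENNReal.toReal_mul] at this
  simpa [signedArea, Measure.real] using this

/-- Cutting off the part near `t 2` costs at most a quarter of the area, and leaves a part of the
triangle that lies in a smaller disc. -/
lemma abs_signedArea_le_volume_inter_closedBall (h : signedArea t ≠ 0) {v : Plane} {M : ℝ}
    (h0 : dist (t 0) v ≤ M) (h1 : dist (t 1) v ≤ M) (h2 : dist (t 2) v ≤ 2 * M) :
    3 / 8 * |signedArea t| ≤
      volume.real (interior (triangle t) ∩ Metric.closedBall v (3 / 2 * M)) := by
  have hM : 0 ≤ M := dist_nonneg.trans h0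
  have hsub : triangle t ⊆ (interior (triangle t) ∩ Metric.closedBall v (3 / 2 * M) ∪
      frontier (triangle t)) ∪ AffineMap.homothety (t 2) (1 / 2 : ℝ) '' triangle t := by
    intro x hx
    obtain ⟨α, β, γ, hα, hβ, hγ, hs, rfl⟩ := exists_eq_of_mem_triangle h hx
    rcases le_total γ (1 / 2) with hγ2 | hγ2
    · left
      by_cases hi : α • t 0 + β • t 1 + γ • t 2 ∈ interior (triangle t)
      · refine Or.inl ⟨hi, ?_⟩
        rw [mem_closedBall_iff_norm]
        have e : α • t 0 + β • t 1 + γ • t 2 - v =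
            α • (t 0 - v) + β • (t 1 - v) + γ • (t 2 - v) := by
          obtain rfl : α = 1 - β - γ := by linarith
          module
        rw [dist_eq_norm] at h0 h1 h2
        rw [e]
        calc _ ≤ α * ‖t 0 - v‖ + β * ‖t 1 - v‖ + γ * ‖t 2 - v‖ := by
              refine (norm_add₃_le).trans (le_of_eq ?_)
              rw [norm_smul, norm_smul, norm_smul, Real.norm_of_nonneg hα, Real.norm_of_nonneg hβ,
                Real.norm_of_nonneg hγ]
          _ ≤ α * M + β * M + γ * (2 * M) := by gcongr
          _ = (1 + γ) * M := by rw [← hs]; ring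
          _ ≤ 3 / 2 * M := by gcongr; linarith
      · exact Or.inr ⟨subset_closure hx, hi⟩
    · right
      refine ⟨(2 * α) • t 0 + (2 * β) • t 1 + (2 * γ - 1) • t 2,
        smul_add_smul_add_smul_mem_triangle t (by linarith) (by linarith) (by linarith)
          (by linarith), ?_⟩
      rw [AffineMap.homothety_apply, vsub_eq_sub, vadd_eq_add]
      module
  have hfin : volume (interior (triangle t) ∩ Metric.closedBall v (3 / 2 * M)) ≠ ⊤ :=
    ((measure_mono (Set.inter_subset_left.trans interior_subset)).trans_lt
      (volume_triangle_ne_top t).lt_top).ne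
  have hle : volume (triangle t) ≤ volume (interior (triangle t) ∩ Metric.closedBall v (3 / 2 * M))
      + ENNReal.ofReal (1 / 4) * volume (triangle t) := by
    refine (measure_mono hsub).trans ((measure_union_le _ _).trans ?_)
    refine add_le_add ((measure_union_le _ _).trans ?_) ?_
    · rw [(convex_triangle t).addHaar_frontier volume, add_zero]
    · rw [Measure.addHaar_image_homothety]
      norm_num
  have hfin' : ENNReal.ofReal (1 / 4) * volume (triangle t) ≠ ⊤ :=
    ENNReal.mul_ne_top ENNReal.ofReal_ne_top (volume_triangle_ne_top t)
  have := ENNReal.toReal_mono (ENNReal.add_ne_top.2 ⟨hfin, hfin'⟩) hle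
  rw [ENNReal.toReal_add hfin hfin', ENNReal.toReal_mul, ENNReal.toReal_ofReal (by norm_num)] at this
  have := abs_signedArea_le t
  simp only [Measure.real] at *
  linarith

lemma dist_sq_plane (p q : Plane) : dist p q ^ 2 = (p 0 - q 0) ^ 2 + (p 1 - q 1) ^ 2 := by
  rw [EuclideanSpace.dist_eq, Real.sq_sqrt (by positivity), Fin.sum_univ_two, Real.dist_eq,
    Real.dist_eq, sq_abs, sq_abs]

lemma heron_lower_bound {X Y A B C : ℝ} (hX : 0 ≤ X) (hXY : Y ≤ 4 * X) (hA : A ∈ Set.Icc X Y)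
    (hB : B ∈ Set.Icc X Y) (hC : C ∈ Set.Icc X Y) :
    3 * Y * (X - Y / 4) ≤ 2 * A * B + 2 * B * C + 2 * C * A - A ^ 2 - B ^ 2 - C ^ 2 := by
  have concave : ∀ p q Z : ℝ, Z ∈ Set.Icc X Y → 0 ≤ -X ^ 2 + p * X + q → 0 ≤ -Y ^ 2 + p * Y + q →
      0 ≤ -Z ^ 2 + p * Z + q := by
    rintro p q Z ⟨h1, h2⟩ hx hy
    rcases (h1.trans h2).eq_or_lt with rfl | hlt
    · rwa [le_antisymm h2 h1]
    · have e : (Y - X) * (-Z ^ 2 + p * Z + q) = (Z - X) * (-Y ^ 2 + p * Y + q) +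
        (Y - Z) * (-X ^ 2 + p * X + q) + (Y - X) * ((Z - X) * (Y - Z)) := by ring
      have h3 := sub_nonneg.2 h1
      have h4 := sub_nonneg.2 h2
      have h5 := sub_pos.2 hlt
      exact nonneg_of_mul_nonneg_right (e ▸ by positivity) h5
  have hle : X ≤ Y := hA.1.trans hA.2
  have key : ∀ A B C : ℝ, (A = X ∨ A = Y) → (B = X ∨ B = Y) → (C = X ∨ C = Y) →
      3 * Y * (X - Y / 4) ≤ 2 * A * B + 2 * B * C + 2 * C * A - A ^ 2 - B ^ 2 - C ^ 2 := by
    intro A B C hA hB hC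
    rcases hA with hA | hA <;> rcases hB with hB | hB <;> rcases hC with hC | hC <;>
      rw [hA, hB, hC] <;>
      nlinarith [sq_nonneg (X - Y / 2), mul_nonneg hX (sub_nonneg.2 hle),
        mul_nonneg (hX.trans hle) (sub_nonneg.2 hXY), mul_nonneg (hX.trans hle) (sub_nonneg.2 hle),
        mul_nonneg hX hX]
  have step₁ : ∀ A B : ℝ, (A = X ∨ A = Y) → (B = X ∨ B = Y) →
      3 * Y * (X - Y / 4) ≤ 2 * A * B + 2 * B * C + 2 * C * A - A ^ 2 - B ^ 2 - C ^ 2 := by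
    intro A B hA hB
    have := concave (2 * A + 2 * B) (2 * A * B - A ^ 2 - B ^ 2 - 3 * Y * (X - Y / 4)) C hC
      (by linarith [key A B X hA hB (.inl rfl)]) (by linarith [key A B Y hA hB (.inr rfl)])
    linarith
  have step₂ : ∀ A : ℝ, (A = X ∨ A = Y) →
      3 * Y * (X - Y / 4) ≤ 2 * A * B + 2 * B * C + 2 * C * A - A ^ 2 - B ^ 2 - C ^ 2 := by
    intro A hA
    have := concave (2 * A + 2 * C) (2 * A * C - A ^ 2 - C ^ 2 - 3 * Y * (X - Y / 4)) B hB
      (by linarith [step₁ A X hA (.inl rfl)]) (by linarith [step₁ A Y hA (.inr rfl)])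
    linarith
  have := concave (2 * B + 2 * C) (2 * B * C - B ^ 2 - C ^ 2 - 3 * Y * (X - Y / 4)) A hA
    (by linarith [step₂ X (.inl rfl)]) (by linarith [step₂ Y (.inr rfl)])
  linarith

lemma signedArea_sq_lower_bound {X Y : ℝ} (hX : 0 ≤ X) (hXY : Y ≤ 4 * X)
    (h : Pairwise fun i j => dist (t i) (t j) ^ 2 ∈ Set.Icc X Y) :
    3 / 4 * (Y * (X - Y / 4)) ≤ signedArea t ^ 2 := by
  have h01 := h (show (0 : Fin 3) ≠ 1 by decide)
  have h02 := h (show (0 : Fin 3) ≠ 2 by decide)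
  have h12 := h (show (1 : Fin 3) ≠ 2 by decide)
  have := heron_lower_bound hX hXY h01 h02 h12
  simp only [dist_sq_plane] at this
  rw [signedArea]
  linarith

end Area

section Fan

variable {k : ℕ}

/-- The vertices `u_j`, `u_{j+1}`, `w_{j+1}` of a pendant triangle of `G_k`. -/
def pendantTriangle (j : Fin (k + 1)) : Fin 3 → GkV k :=
  ![Sum.inr (Sum.inl j.castSucc), Sum.inr (Sum.inl j.succ), Sum.inr (Sum.inr j)]

lemma Gk_adj_apex (l : Fin (k + 2)) : (Gk k).Adj (Sum.inr (Sum.inl l)) (Sum.inl ()) := by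
  simp [Gk, SimpleGraph.fromRel_adj]

lemma Gk_adj_pendantTriangle (j : Fin (k + 1)) :
    Pairwise fun a b => (Gk k).Adj (pendantTriangle j a) (pendantTriangle j b) := by
  have h01 : (Gk k).Adj (pendantTriangle j 0) (pendantTriangle j 1) :=
    (SimpleGraph.fromRel_adj ..).2 ⟨by simp [pendantTriangle, Fin.ext_iff],
      Or.inl (Or.inr (Or.inl ⟨_, _, rfl, rfl, by simp⟩))⟩
  have h20 : (Gk k).Adj (pendantTriangle j 2) (pendantTriangle j 0) :=
    (SimpleGraph.fromRel_adj ..).2 ⟨by simp [pendantTriangle],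
      Or.inl (Or.inr (Or.inr ⟨_, _, rfl, rfl, Or.inl (by simp)⟩))⟩
  have h21 : (Gk k).Adj (pendantTriangle j 2) (pendantTriangle j 1) :=
    (SimpleGraph.fromRel_adj ..).2 ⟨by simp [pendantTriangle],
      Or.inl (Or.inr (Or.inr ⟨_, _, rfl, rfl, Or.inr (by simp)⟩))⟩
  intro a b hab
  fin_cases a <;> fin_cases b
  exacts [absurd rfl hab, h01, h20.symm, h01.symm, absurd rfl hab, h21.symm, h20, h21,
    absurd rfl hab]

lemma apex_notMem_pendantTriangle (j : Fin (k + 1)) :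
    (Sum.inl () : GkV k) ∉ Set.range (pendantTriangle j) := by
  rintro ⟨a, ha⟩
  fin_cases a <;> simp [pendantTriangle] at ha

lemma pendant_notMem_pendantTriangle {i j : Fin (k + 1)} (h : i ≠ j) :
    pendantTriangle i 2 ∉ Set.range (pendantTriangle j) := by
  rintro ⟨a, ha⟩
  fin_cases a <;> simp [pendantTriangle] at ha
  exact h ha.symm

lemma fan_notMem_pendantTriangle {i j : Fin (k + 1)} (h : i ≠ j) :
    pendantTriangle i 0 ∉ Set.range (pendantTriangle j) ∨
      pendantTriangle i 1 ∉ Set.range (pendantTriangle j) := by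
  by_contra! hc
  obtain ⟨⟨a, ha⟩, b, hb⟩ := hc
  apply h
  fin_cases a <;> fin_cases b <;> simp [pendantTriangle, Fin.ext_iff] at ha hb ⊢ <;> omega

lemma pendantTriangle_notMem_or_notMem {i j : Fin (k + 1)} (h : i ≠ j) (a b : Fin 3)
    (hab : a ≠ b) : pendantTriangle i a ∉ Set.range (pendantTriangle j) ∨
      pendantTriangle i b ∉ Set.range (pendantTriangle j) := by
  have h2 := pendant_notMem_pendantTriangle h
  have h1 := fan_notMem_pendantTriangle h
  fin_cases a <;> fin_cases b
  exacts [absurd rfl hab, h1, .inr h2, h1.symm, absurd rfl hab, .inr h2, .inl h2, .inl h2,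
    absurd rfl hab]

variable {ρ : GkV k → Plane} {i j : Fin (k + 1)}

lemma Gk_adj_pendantTriangle_apex (j : Fin (k + 1)) {a : Fin 3} (ha : a ≠ 2) :
    (Gk k).Adj (pendantTriangle j a) (Sum.inl ()) := by
  fin_cases a
  · exact Gk_adj_apex _
  · exact Gk_adj_apex _
  · exact absurd rfl ha

lemma exists_fan_notMem_pendantTriangle (h : i ≠ j) :
    ∃ a : Fin 3, a ≠ 2 ∧ pendantTriangle i a ∉ Set.range (pendantTriangle j) := by
  rcases fan_notMem_pendantTriangle h with h | h
  · exact ⟨0, by decide, h⟩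
  · exact ⟨1, by decide, h⟩

lemma apex_mem_interior_of_vertex_mem (hρ : IsPlanarDrawing (Gk k) ρ) (h : i ≠ j)
    (hj : signedArea (ρ ∘ pendantTriangle j) ≠ 0) {a : Fin 3}
    (ha : ρ (pendantTriangle i a) ∈ interior (triangle (ρ ∘ pendantTriangle j))) :
    ρ (Sum.inl ()) ∈ interior (triangle (ρ ∘ pendantTriangle j)) := by
  have of_fan : ∀ a : Fin 3, a ≠ 2 →
      ρ (pendantTriangle i a) ∈ interior (triangle (ρ ∘ pendantTriangle j)) →
      ρ (Sum.inl ()) ∈ interior (triangle (ρ ∘ pendantTriangle j)) := fun a ha2 ha =>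
    mem_interior_of_adj hρ (Gk_adj_pendantTriangle j) hj (Gk_adj_pendantTriangle_apex i ha2)
      (apex_notMem_pendantTriangle j) ⟨_, left_mem_segment ℝ _ _, ha⟩
  by_cases ha2 : a = 2
  · subst ha2
    obtain ⟨b, hb2, hb⟩ := exists_fan_notMem_pendantTriangle h
    exact of_fan b hb2 (mem_interior_of_adj hρ (Gk_adj_pendantTriangle j) hj
      (Gk_adj_pendantTriangle i hb2.symm) hb ⟨_, left_mem_segment ℝ _ _, ha⟩)
  · exact of_fan a ha2 ha

lemma apex_mem_interior_of_inter_nonempty (hρ : IsPlanarDrawing (Gk k) ρ) (h : i ≠ j)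
    (hi : signedArea (ρ ∘ pendantTriangle i) ≠ 0) (hj : signedArea (ρ ∘ pendantTriangle j) ≠ 0)
    (hne : (interior (triangle (ρ ∘ pendantTriangle i)) ∩
      interior (triangle (ρ ∘ pendantTriangle j))).Nonempty) :
    ρ (Sum.inl ()) ∈ interior (triangle (ρ ∘ pendantTriangle i)) ∨
      ρ (Sum.inl ()) ∈ interior (triangle (ρ ∘ pendantTriangle j)) := by
  rcases exists_vertex_mem_interior hρ (Gk_adj_pendantTriangle i) (Gk_adj_pendantTriangle j) hi hj
    (pendantTriangle_notMem_or_notMem h) (pendantTriangle_notMem_or_notMem h.symm) hne with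
    ⟨a, ha⟩ | ⟨a, ha⟩
  · exact Or.inr (apex_mem_interior_of_vertex_mem hρ h hj ha)
  · exact Or.inl (apex_mem_interior_of_vertex_mem hρ h.symm hi ha)

lemma eq_of_apex_mem_interior (hρ : IsPlanarDrawing (Gk k) ρ)
    (hi : signedArea (ρ ∘ pendantTriangle i) ≠ 0) (hj : signedArea (ρ ∘ pendantTriangle j) ≠ 0)
    (hvi : ρ (Sum.inl ()) ∈ interior (triangle (ρ ∘ pendantTriangle i)))
    (hvj : ρ (Sum.inl ()) ∈ interior (triangle (ρ ∘ pendantTriangle j))) : i = j := by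
  by_contra h
  have fan_mem : ∀ i j : Fin (k + 1), signedArea (ρ ∘ pendantTriangle j) ≠ 0 →
      ρ (Sum.inl ()) ∈ interior (triangle (ρ ∘ pendantTriangle j)) → ∀ a : Fin 3, a ≠ 2 →
      pendantTriangle i a ∉ Set.range (pendantTriangle j) →
      ρ (pendantTriangle i a) ∈ interior (triangle (ρ ∘ pendantTriangle j)) :=
    fun i j hj hv a ha hna => mem_interior_of_adj hρ (Gk_adj_pendantTriangle j) hj
      (Gk_adj_pendantTriangle_apex i ha).symm hna ⟨_, left_mem_segment ℝ _ _, hv⟩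
  have pendant_mem : ∀ i j : Fin (k + 1), i ≠ j → signedArea (ρ ∘ pendantTriangle j) ≠ 0 →
      ρ (Sum.inl ()) ∈ interior (triangle (ρ ∘ pendantTriangle j)) →
      ρ (pendantTriangle i 2) ∈ interior (triangle (ρ ∘ pendantTriangle j)) := by
    intro i j h hj hv
    obtain ⟨a, ha2, ha⟩ := exists_fan_notMem_pendantTriangle h
    exact mem_interior_of_adj hρ (Gk_adj_pendantTriangle j) hj (Gk_adj_pendantTriangle i ha2)
      (pendant_notMem_pendantTriangle h) ⟨_, left_mem_segment ℝ _ _, fan_mem i j hj hv a ha2 ha⟩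
  have hsub : triangle (ρ ∘ pendantTriangle j) ⊆ triangle (ρ ∘ pendantTriangle i) := by
    refine convexHull_min ?_ (convex_triangle _)
    rintro _ ⟨a, rfl⟩
    by_cases ha : pendantTriangle j a ∈ Set.range (pendantTriangle i)
    · obtain ⟨b, hb⟩ := ha
      rw [Function.comp_apply, ← hb]
      exact vertex_mem_triangle (ρ ∘ pendantTriangle i) b
    · by_cases ha2 : a = 2
      · subst ha2
        exact interior_subset (pendant_mem j i (Ne.symm h) hi hvi)
      · exact interior_subset (fan_mem j i hi hvi a ha2 ha)
  exact vertex_notMem_interior hi 2 (interior_mono hsub (pendant_mem i j h hj hvj))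

lemma mul_sqrt_le_of_dist_mem_Icc (hρ : IsPlanarDrawing (Gk k) ρ) {M r : ℝ} (hM : 0 < M)
    (hr : 1 / 2 < r) (hd : ∀ x y, (Gk k).Adj x y → dist (ρ x) (ρ y) ∈ Set.Icc (r * M) M) :
    k * √(r ^ 2 - 1 / 4) ≤ 8 * Real.pi := by
  set s := √(r ^ 2 - 1 / 4) with hs
  have hs0 : 0 < s := Real.sqrt_pos.2 (by nlinarith)
  have hs2 : s ^ 2 = r ^ 2 - 1 / 4 := Real.sq_sqrt (by nlinarith)
  have harea : ∀ j, 3 / 4 * s * M ^ 2 ≤ |signedArea (ρ ∘ pendantTriangle j)| := by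
    intro j
    refine (abs_le_of_sq_le_sq' ?_ (abs_nonneg _)).2
    rw [sq_abs]
    have := signedArea_sq_lower_bound (t := ρ ∘ pendantTriangle j) (X := (r * M) ^ 2) (Y := M ^ 2)
      (by positivity) (by nlinarith [mul_pos hM hM]) fun a b hab => by
        obtain ⟨h1, h2⟩ := hd _ _ (Gk_adj_pendantTriangle j hab)
        exact ⟨pow_le_pow_left₀ (by positivity) h1 2, pow_le_pow_left₀ dist_nonneg h2 2⟩
    refine le_trans ?_ this
    calc (3 / 4 * s * M ^ 2) ^ 2 = 9 / 16 * (s ^ 2 * M ^ 4) := by ring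
      _ ≤ 3 / 4 * (s ^ 2 * M ^ 4) := by gcongr ?_ * _; norm_num
      _ = _ := by rw [hs2]; ring
  have hne : ∀ j, signedArea (ρ ∘ pendantTriangle j) ≠ 0 := fun j =>
    abs_pos.1 (lt_of_lt_of_le (by positivity) (harea j))
  set D := Metric.closedBall (ρ (Sum.inl ())) (3 / 2 * M) with hD
  have hvol : ∀ j, 9 / 32 * s * M ^ 2 ≤
      volume.real (interior (triangle (ρ ∘ pendantTriangle j)) ∩ D) := by
    intro j
    have h0 := (hd _ _ (Gk_adj_pendantTriangle_apex j (a := 0) (by decide))).2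
    have h1 := (hd _ _ (Gk_adj_pendantTriangle_apex j (a := 1) (by decide))).2
    have h2 := (hd _ _ (Gk_adj_pendantTriangle j (show (2 : Fin 3) ≠ 0 by decide))).2
    have := abs_signedArea_le_volume_inter_closedBall (hne j) h0 h1
      ((dist_triangle _ _ _).trans ((add_le_add h2 h0).trans_eq (two_mul M).symm))
    linarith [harea j]
  classical
  set J : Finset (Fin (k + 1)) := Finset.univ.filter fun j =>
    ρ (Sum.inl ()) ∉ interior (triangle (ρ ∘ pendantTriangle j)) with hJ
  have hcard : k ≤ J.card := by
    have h1 : (Finset.univ.filter fun j =>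
        ρ (Sum.inl ()) ∈ interior (triangle (ρ ∘ pendantTriangle j))).card ≤ 1 :=
      Finset.card_le_one.2 fun i hi j hj => eq_of_apex_mem_interior hρ (hne i) (hne j)
        (Finset.mem_filter.1 hi).2 (Finset.mem_filter.1 hj).2
    have h2 : _ + J.card = _ :=
      Finset.card_filter_add_card_filter_not (s := Finset.univ) fun j : Fin (k + 1) =>
        ρ (Sum.inl ()) ∈ interior (triangle (ρ ∘ pendantTriangle j))
    rw [Finset.card_univ, Fintype.card_fin] at h2
    omega
  have hfin : volume D ≠ ⊤ := (isCompact_closedBall _ _).measure_lt_top.ne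
  have hsum : ∑ j ∈ J, volume.real (interior (triangle (ρ ∘ pendantTriangle j)) ∩ D) ≤
      volume.real D := by
    rw [← measureReal_biUnion_finset]
    · exact measureReal_mono (Set.iUnion₂_subset fun _ _ => Set.inter_subset_right) hfin
    · intro i hi j hj hij
      refine Disjoint.inter_left D (Disjoint.inter_right D ?_)
      by_contra hc
      rcases apex_mem_interior_of_inter_nonempty hρ hij (hne i) (hne j)
        (Set.not_disjoint_iff_nonempty_inter.1 hc) with h | h
      · exact (Finset.mem_filter.1 hi).2 h
      · exact (Finset.mem_filter.1 hj).2 h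
    · exact fun j _ => isOpen_interior.measurableSet.inter Metric.isClosed_closedBall.measurableSet
  have hball : volume.real D = 9 / 4 * Real.pi * M ^ 2 := by
    rw [hD, Measure.real, EuclideanSpace.volume_closedBall_fin_two]
    rw [ENNReal.toReal_mul, ENNReal.toReal_pow, ENNReal.toReal_ofReal (by positivity),
      ENNReal.toReal_ofReal Real.pi_nonneg]
    ring
  have hle : k * (9 / 32 * s * M ^ 2) ≤ 9 / 4 * Real.pi * M ^ 2 := by
    calc k * (9 / 32 * s * M ^ 2) ≤ J.card * (9 / 32 * s * M ^ 2) := by gcongr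
      _ = ∑ j ∈ J, 9 / 32 * s * M ^ 2 := by rw [Finset.sum_const, nsmul_eq_mul]
      _ ≤ ∑ j ∈ J, volume.real (interior (triangle (ρ ∘ pendantTriangle j)) ∩ D) :=
        Finset.sum_le_sum fun j _ => hvol j
      _ ≤ _ := hsum.trans_eq hball
  have hM2 : 0 < M ^ 2 := by positivity
  refine le_of_mul_le_mul_right ?_ hM2
  linarith

end Fan

/-- For 0 < ε < 2, δ = ε/(2(2−ε)) and an integer k > 8π/√(δ + δ²), every
planar straight-line drawing of `G_k` has edge-length ratio strictly greater than 2 − ε. -/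
theorem Gk_ratio_gt (ε δ : ℝ) (hε₀ : 0 < ε) (hε₂ : ε < 2)
    (hδ : δ = ε / (2 * (2 - ε))) (k : ℕ)
    (hk : 8 * Real.pi / Real.sqrt (δ + δ ^ 2) < (k : ℝ)) :
    ∀ ρ : GkV k → Plane, IsPlanarDrawing (Gk k) ρ → 2 - ε < edgeLengthRatio (Gk k) ρ := by

  intro ρ hρ
  by_contra! hle
  set S := {d : ℝ | ∃ u v, (Gk k).Adj u v ∧ d = dist (ρ u) (ρ v)} with hS
  have hfin : S.Finite := by
    refine (Set.finite_range fun p : GkV k × GkV k => dist (ρ p.1) (ρ p.2)).subset ?_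
    rintro _ ⟨u, v, -, rfl⟩
    exact ⟨(u, v), rfl⟩
  have hne : S.Nonempty := ⟨_, _, _, Gk_adj_apex 0, rfl⟩
  have hm : 0 < sInf S := by
    obtain ⟨u, v, huv, h⟩ := hne.csInf_mem hfin
    rw [h]
    exact dist_pos.2 (hρ.1.ne huv.ne)
  have hM : 0 < sSup S := hm.trans_le (csInf_le_csSup hne hfin.bddBelow hfin.bddAbove)
  have hε : 0 < 2 - ε := by linarith
  have hr : 1 / 2 + δ = 1 / (2 - ε) := by rw [hδ]; field_simp; ring
  have hδ₀ : 0 < δ := by rw [hδ]; positivity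
  have hrM : (1 / 2 + δ) * sSup S ≤ sInf S := by
    rw [hr, one_div_mul_eq_div, div_le_iff₀ hε, mul_comm]
    exact (div_le_iff₀ hm).1 hle
  have h := mul_sqrt_le_of_dist_mem_Icc hρ hM (r := 1 / 2 + δ) (by linarith) fun x y hxy =>
    ⟨hrM.trans (csInf_le hfin.bddBelow ⟨x, y, hxy, rfl⟩), le_csSup hfin.bddAbove ⟨x, y, hxy, rfl⟩⟩
  rw [show (1 / 2 + δ) ^ 2 - 1 / 4 = δ + δ ^ 2 by ring] at h
  rw [div_lt_iff₀ (Real.sqrt_pos.2 (by positivity))] at hk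
  exact absurd hk h.not_gt
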